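/- arXiv:1804.05622 — 2 statements merged into one kernel-verified Lean document; each statement's English description precedes it below -/
import Mathlib

section
/- Let d ≥ 1, let (Ω, 𝒜, ℙ) be a probability space, and let (T_t)_{t∈ℝ^d} be a jointly measurable action of the additive group ℝ^d on Ω (T_0 = id and T_{s+t} = T_s ∘ T_t for all s,t ∈ ℝ^d) such that each T_t is measure preserving for ℙ. Assume the action is ergodic, i.e. every measurable set A ⊆ Ω with T_t^{-1}A = A for all t ∈ ℝ^d satisfies ℙ(A) ∈ {0,1}. Then for every integrable function f : Ω → ℝ, for ℙ-almost every ω ∈ Ω, the ball averages (1/λ_d(B_n)) ∫_{B_n} f(T_t ω) λ_d(dt) converge, as n → ∞ over the natural numbers, to the expectation ∫_Ω f dℙ. -/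
open MeasureTheory Filter

namespace ErgodicFlow

set_option linter.unusedSectionVars false

open Metric Set
open scoped ENNReal Topology

variable {E Ω : Type*} [NormedAddCommGroup E] [NormedSpace ℝ E] [FiniteDimensional ℝ E]
  [MeasurableSpace E] [BorelSpace E] [MeasurableSpace Ω]
  {μ : Measure E} [μ.IsAddHaarMeasure] {P : Measure Ω} [IsProbabilityMeasure P]
  {T : E → Ω → Ω}

/-- A jointly measurable action of the additive group `E` on `Ω` preserving the measure `P`. -/
structure IsMeasurePreservingFlow (P : Measure Ω) (T : E → Ω → Ω) : Prop where
  measurable : Measurable fun p : E × Ω => T p.1 p.2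
  zero : T 0 = id
  add : ∀ s t, T (s + t) = T s ∘ T t
  measurePreserving : ∀ t, MeasurePreserving (T t) P P

/-- The average of `f` along the orbit of `ω` over the closed ball of radius `r`. -/
noncomputable def ballAverage (μ : Measure E) (T : E → Ω → Ω) (f : Ω → ℝ) (r : ℝ) (ω : Ω) : ℝ :=
  (μ (closedBall (0 : E) r)).toReal⁻¹ * ∫ t in closedBall (0 : E) r, f (T t ω) ∂μ

/-- The ball averages of `f` converge almost everywhere to the mean of `f`. -/
def AverageTendsto (μ : Measure E) (P : Measure Ω) (T : E → Ω → Ω) (f : Ω → ℝ) : Prop :=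
  ∀ᵐ ω ∂P, Tendsto (fun n : ℕ => ballAverage μ T f n ω) atTop (𝓝 (∫ x, f x ∂P))

/-- A Vitali covering estimate: if around every point of `D` the mass of `φ` on some ball is at
least `c` times its volume, then `c * μ D` is controlled by the total mass of `φ`. -/
theorem mul_measure_le_of_forall_closedBall (φ : E → ℝ≥0∞) (c : ℝ≥0∞) {D : Set E} {R N : ℝ}
    (hD : D ⊆ closedBall 0 R) (r : E → ℝ) (hr : ∀ s ∈ D, 0 < r s) (hrN : ∀ s ∈ D, r s ≤ N)
    (h : ∀ s ∈ D, c * μ (closedBall s (r s)) ≤ ∫⁻ t in closedBall s (r s), φ t ∂μ) :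
    c * μ D ≤ 5 ^ Module.finrank ℝ E * ∫⁻ t in closedBall 0 (R + N), φ t ∂μ := by
  obtain ⟨u, huD, hdisj, hcov⟩ :=
    Vitali.exists_disjoint_subfamily_covering_enlargement_closedBall D id r N hrN 5 (by norm_num)
  simp only [id] at hdisj hcov
  have hucount : u.Countable := hdisj.countable_of_nonempty_interior fun s hs =>
    ⟨s, ball_subset_interior_closedBall (mem_ball_self (hr s (huD hs)))⟩
  have hDsub : D ⊆ ⋃ s ∈ u, closedBall s (5 * r s) := fun s hs => by
    obtain ⟨b, hb, hsb⟩ := hcov s hs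
    exact mem_biUnion hb (hsb (mem_closedBall_self (hr s hs).le))
  have hscale : ∀ s ∈ u, μ (closedBall s (5 * r s)) =
      5 ^ Module.finrank ℝ E * μ (closedBall s (r s)) := fun s hs => by
    have h0 := (hr s (huD hs)).le
    rw [Measure.addHaar_closedBall μ s (by positivity), Measure.addHaar_closedBall μ s h0,
      mul_pow, ENNReal.ofReal_mul (by positivity), ENNReal.ofReal_pow (by norm_num), mul_assoc]
    norm_num
  calc c * μ D ≤ c * ∑' s : u, μ (closedBall (s : E) (5 * r s)) := by
        gcongr
        exact (measure_mono hDsub).trans (measure_biUnion_le μ hucount _)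
    _ = ∑' s : u, 5 ^ Module.finrank ℝ E * (c * μ (closedBall (s : E) (r s))) := by
        rw [← ENNReal.tsum_mul_left]
        exact tsum_congr fun s => by rw [hscale s s.2]; ring
    _ ≤ ∑' s : u, 5 ^ Module.finrank ℝ E * ∫⁻ t in closedBall (s : E) (r s), φ t ∂μ :=
        ENNReal.tsum_le_tsum fun s => by gcongr; exact h s (huD s.2)
    _ = 5 ^ Module.finrank ℝ E * ∫⁻ t in ⋃ s ∈ u, closedBall (s : E) (r s), φ t ∂μ := by
        rw [ENNReal.tsum_mul_left,
          lintegral_biUnion hucount (fun s _ => measurableSet_closedBall) hdisj]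
    _ ≤ _ := by
        gcongr
        refine iUnion₂_subset fun s hs => closedBall_subset_closedBall' ?_
        have := mem_closedBall.1 (hD (huD hs))
        linarith [hrN s (huD hs)]

theorem ballAverage_const {r : ℝ} (hr : 0 < r) (c : ℝ) (ω : Ω) :
    ballAverage μ T (fun _ => c) r ω = c := by
  have hv : 0 < (μ (closedBall (0 : E) r)).toReal :=
    ENNReal.toReal_pos (measure_closedBall_pos μ _ hr).ne' measure_closedBall_lt_top.ne
  simp [ballAverage, Measure.real, hv.ne']

theorem averageTendsto_const (c : ℝ) : AverageTendsto μ P T (fun _ => c) := by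
  refine ae_of_all _ fun ω => ?_
  simp only [integral_const, probReal_univ, one_smul]
  refine tendsto_const_nhds.congr' ?_
  filter_upwards [eventually_ge_atTop 1] with n hn
  rw [ballAverage_const (by exact_mod_cast hn)]

theorem averageTendsto_const_smul (c : ℝ) {f : Ω → ℝ} (hf : AverageTendsto μ P T f) :
    AverageTendsto μ P T (c • f) := by
  filter_upwards [hf] with ω hω
  simp only [Pi.smul_apply, smul_eq_mul]
  rw [integral_const_mul]
  refine (hω.const_mul c).congr fun n => ?_
  simp only [ballAverage, Pi.smul_apply, smul_eq_mul]
  rw [integral_const_mul, mul_left_comm]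

theorem measureReal_inter_closedBall_le (D : Set E) (x y : E) (r : ℝ) :
    μ.real (D ∩ closedBall x r) ≤ μ.real (D ∩ closedBall y r) +
      (μ.real (closedBall (0 : E) (r + dist x y)) - μ.real (closedBall (0 : E) r)) := by
  have hsub : D ∩ closedBall x r ⊆
      (D ∩ closedBall y r) ∪ (closedBall y (r + dist x y) \ closedBall y r) := by
    rintro z ⟨hzD, hz⟩
    by_cases hzy : z ∈ closedBall y r
    · exact Or.inl ⟨hzD, hzy⟩
    · exact Or.inr ⟨closedBall_subset_closedBall' le_rfl hz, hzy⟩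
  have hfin : ∀ r : ℝ, μ (closedBall y r) ≠ ∞ := fun r => measure_closedBall_lt_top.ne
  have hdiff : μ.real (closedBall y (r + dist x y) \ closedBall y r) =
      μ.real (closedBall (0 : E) (r + dist x y)) - μ.real (closedBall (0 : E) r) := by
    rw [measureReal_sdiff (closedBall_subset_closedBall (le_add_of_nonneg_right dist_nonneg))
      measurableSet_closedBall (hfin _)]
    simp [Measure.real, Measure.addHaar_closedBall_center]
  rw [← hdiff]
  refine (measureReal_mono hsub (measure_union_ne_top ?_ ?_)).trans (measureReal_union_le _ _)
  · exact measure_ne_top_of_subset inter_subset_right (hfin r)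
  · exact measure_ne_top_of_subset sdiff_subset (hfin _)

namespace IsMeasurePreservingFlow

theorem measurable_orbit (hT : IsMeasurePreservingFlow P T) (ω : Ω) :
    Measurable fun t => T t ω :=
  hT.measurable.comp measurable_prodMk_right

theorem ae_orbit (hT : IsMeasurePreservingFlow P T) {p : Ω → Prop} (hp : ∀ᵐ ω ∂P, p ω) :
    ∀ᵐ ω ∂P, ∀ᵐ t ∂μ, p (T t ω) := by
  obtain ⟨N, hN, hNm, hN0⟩ := exists_measurable_superset_of_null (ae_iff.1 hp)
  have h : ∀ᵐ ω ∂P, ∀ᵐ t ∂μ, T t ω ∉ N := by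
    refine (Measure.ae_ae_comm (p := fun t ω => T t ω ∉ N) (hT.measurable hNm.compl)).1
      (ae_of_all _ fun t => ?_)
    exact (hT.measurePreserving t).quasiMeasurePreserving.ae (measure_eq_zero_iff_ae_notMem.1 hN0)
  filter_upwards [h] with ω hω
  filter_upwards [hω] with t ht
  by_contra hc
  exact ht (hN hc)

theorem measurable_setLIntegral_orbit (hT : IsMeasurePreservingFlow P T) {g : Ω → ℝ≥0∞}
    (hg : Measurable g) (s : Set E) : Measurable fun ω => ∫⁻ t in s, g (T t ω) ∂μ :=
  ((hg.comp hT.measurable).comp measurable_swap).lintegral_prod_right'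

theorem lintegral_setLIntegral_orbit (hT : IsMeasurePreservingFlow P T) {g : Ω → ℝ≥0∞}
    (hg : Measurable g) (s : Set E) :
    ∫⁻ ω, ∫⁻ t in s, g (T t ω) ∂μ ∂P = μ s * ∫⁻ ω, g ω ∂P := by
  rw [lintegral_lintegral_swap (f := fun ω t => g (T t ω))
    ((hg.comp hT.measurable).comp measurable_swap).aemeasurable]
  simp [fun t => (hT.measurePreserving t).lintegral_comp hg, mul_comm]

theorem ae_integrableOn_orbit (hT : IsMeasurePreservingFlow P T) {f : Ω → ℝ}
    (hfm : Measurable f) (hf : Integrable f P) :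
    ∀ᵐ ω ∂P, ∀ n : ℕ, IntegrableOn (fun t => f (T t ω)) (closedBall (0 : E) n) μ := by
  rw [ae_all_iff]
  intro n
  have hfin : ∫⁻ ω, ∫⁻ t in closedBall (0 : E) n, ‖f (T t ω)‖ₑ ∂μ ∂P ≠ ∞ := by
    rw [hT.lintegral_setLIntegral_orbit hfm.enorm]
    exact ENNReal.mul_ne_top measure_closedBall_lt_top.ne hf.2.ne
  filter_upwards [ae_lt_top (hT.measurable_setLIntegral_orbit hfm.enorm _) hfin] with ω hω
  exact ⟨(hfm.comp (hT.measurable_orbit ω)).aestronglyMeasurable, hω⟩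

theorem averageTendsto_congr (hT : IsMeasurePreservingFlow P T) {f g : Ω → ℝ}
    (hfg : f =ᵐ[P] g) (hf : AverageTendsto μ P T f) : AverageTendsto μ P T g := by
  filter_upwards [hf, hT.ae_orbit (μ := μ) hfg] with ω hω hae
  rw [← integral_congr_ae hfg]
  refine hω.congr fun n => ?_
  rw [ballAverage, ballAverage, integral_congr_ae (ae_restrict_of_ae hae)]

/-- The weak type (1, 1) maximal inequality for ball averages with radii at most `N`. -/
theorem mul_measure_exists_radius_le_gt (hT : IsMeasurePreservingFlow P T) {g : Ω → ℝ≥0∞}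
    (hg : Measurable g) (c : ℝ≥0∞) (N : ℕ) :
    c * P {ω | ∃ n : ℕ, 1 ≤ n ∧ n ≤ N ∧ c * μ (closedBall (0 : E) n) <
      ∫⁻ t in closedBall (0 : E) n, g (T t ω) ∂μ} ≤
      10 ^ Module.finrank ℝ E * ∫⁻ ω, g ω ∂P := by
  set A := {ω | ∃ n : ℕ, 1 ≤ n ∧ n ≤ N ∧ c * μ (closedBall (0 : E) n) <
      ∫⁻ t in closedBall (0 : E) n, g (T t ω) ∂μ} with hA
  rcases Nat.eq_zero_or_pos N with rfl | hN
  · have : A = ∅ := by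
      ext ω
      simp only [hA, mem_ofPred_eq, mem_empty_iff_false, iff_false]
      rintro ⟨n, h1, h2, -⟩
      omega
    simp [this]
  have hNpos : (0 : ℝ) < N := by exact_mod_cast hN
  have hAm : MeasurableSet A := by
    have : A = ⋃ n : ℕ, ⋃ _ : 1 ≤ n ∧ n ≤ N, {ω | c * μ (closedBall (0 : E) n) <
        ∫⁻ t in closedBall (0 : E) n, g (T t ω) ∂μ} := by
      ext ω; simp [hA, and_assoc]
    rw [this]
    refine MeasurableSet.iUnion fun n => MeasurableSet.iUnion fun _ => ?_
    exact measurableSet_lt measurable_const (hT.measurable_setLIntegral_orbit hg _)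
  have hpoint : ∀ ω, c * ∫⁻ t in closedBall (0 : E) N, A.indicator 1 (T t ω) ∂μ ≤
      5 ^ Module.finrank ℝ E * ∫⁻ t in closedBall (0 : E) (N + N), g (T t ω) ∂μ := by
    intro ω
    have hDm : MeasurableSet ((fun t => T t ω) ⁻¹' A) := hT.measurable_orbit ω hAm
    have hD : ∫⁻ t in closedBall (0 : E) N, A.indicator 1 (T t ω) ∂μ =
        μ ((fun t => T t ω) ⁻¹' A ∩ closedBall 0 N) := by
      rw [← Measure.restrict_apply hDm, ← lintegral_indicator_one hDm]
      rfl
    rw [hD]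
    have hex : ∀ s ∈ (fun t => T t ω) ⁻¹' A ∩ closedBall 0 N, ∃ n : ℕ, 1 ≤ n ∧ n ≤ N ∧
        c * μ (closedBall (0 : E) n) < ∫⁻ t in closedBall (0 : E) n, g (T t (T s ω)) ∂μ :=
      fun s hs => hs.1
    choose! r hr1 hrN hr using hex
    refine mul_measure_le_of_forall_closedBall (μ := μ) _ c inter_subset_right
      (fun s => (r s : ℝ)) (fun s hs => by exact_mod_cast hr1 s hs)
      (fun s hs => by exact_mod_cast hrN s hs) fun s hs => ?_
    have htrans : ∫⁻ t in closedBall s (r s : ℝ), g (T t ω) ∂μ =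
        ∫⁻ t in closedBall (0 : E) (r s : ℝ), g (T t (T s ω)) ∂μ := by
      rw [← (measurePreserving_add_right μ s).setLIntegral_comp_preimage_emb
        (MeasurableEquiv.addRight s).measurableEmbedding]
      have : (fun x => x + s) ⁻¹' closedBall s (r s : ℝ) = closedBall (0 : E) (r s : ℝ) := by
        ext x; simp
      rw [this]
      simp [hT.add]
    rw [htrans, Measure.addHaar_closedBall_center]
    exact (hr s hs).le
  have hint := lintegral_mono (μ := P) hpoint
  have hind : Measurable (A.indicator (1 : Ω → ℝ≥0∞)) := measurable_one.indicator hAm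
  rw [lintegral_const_mul _ (hT.measurable_setLIntegral_orbit hind _),
    lintegral_const_mul' _ _ (by finiteness), hT.lintegral_setLIntegral_orbit hg,
    hT.lintegral_setLIntegral_orbit hind, lintegral_indicator_one hAm] at hint
  have hball : μ (closedBall (0 : E) (N + N)) =
      2 ^ Module.finrank ℝ E * μ (closedBall (0 : E) N) := by
    rw [← two_mul, Measure.addHaar_closedBall μ _ (by positivity),
      Measure.addHaar_closedBall μ _ hNpos.le,
      mul_pow, ENNReal.ofReal_mul (by positivity), ENNReal.ofReal_pow (by norm_num), mul_assoc]
    norm_num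
  rw [hball] at hint
  have h10 : (10 : ℝ≥0∞) ^ Module.finrank ℝ E =
      5 ^ Module.finrank ℝ E * 2 ^ Module.finrank ℝ E := by
    rw [← mul_pow]; norm_num
  rw [← ENNReal.mul_le_mul_iff_right (measure_closedBall_pos μ (0 : E) hNpos).ne'
    measure_closedBall_lt_top.ne, h10]
  calc _ = _ := by ring
    _ ≤ _ := hint
    _ = _ := by ring

/-- The weak type (1, 1) maximal inequality for ball averages. -/
theorem mul_measure_exists_gt (hT : IsMeasurePreservingFlow P T) {g : Ω → ℝ≥0∞}
    (hg : Measurable g) (c : ℝ≥0∞) :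
    c * P {ω | ∃ n : ℕ, 1 ≤ n ∧ c * μ (closedBall (0 : E) n) <
      ∫⁻ t in closedBall (0 : E) n, g (T t ω) ∂μ} ≤
      10 ^ Module.finrank ℝ E * ∫⁻ ω, g ω ∂P := by
  have hU : {ω | ∃ n : ℕ, 1 ≤ n ∧ c * μ (closedBall (0 : E) n) <
      ∫⁻ t in closedBall (0 : E) n, g (T t ω) ∂μ} =
      ⋃ N : ℕ, {ω | ∃ n : ℕ, 1 ≤ n ∧ n ≤ N ∧ c * μ (closedBall (0 : E) n) <
      ∫⁻ t in closedBall (0 : E) n, g (T t ω) ∂μ} := by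
    ext ω
    simp only [mem_ofPred_eq, mem_iUnion]
    exact ⟨fun ⟨n, h1, h⟩ => ⟨n, n, h1, le_rfl, h⟩, fun ⟨_, n, h1, _, h⟩ => ⟨n, h1, h⟩⟩
  rw [hU, Monotone.measure_iUnion, ENNReal.mul_iSup]
  · exact iSup_le fun N => hT.mul_measure_exists_radius_le_gt hg c N
  · exact fun M N hMN ω ⟨n, h1, h2, h⟩ => ⟨n, h1, h2.trans hMN, h⟩

/-- Almost everywhere convergence of ball averages is stable under `L¹` approximation. -/
theorem averageTendsto_of_forall_approx (hT : IsMeasurePreservingFlow P T) {f : Ω → ℝ}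
    (hfm : Measurable f) (hf : Integrable f P)
    (h : ∀ ε : ℝ, 0 < ε → ∃ g : Ω → ℝ, Measurable g ∧ Integrable g P ∧
      AverageTendsto μ P T g ∧ ∫⁻ ω, ‖f ω - g ω‖ₑ ∂P ≤ ENNReal.ofReal ε) :
    AverageTendsto μ P T f := by
  have key : ∀ δ : ℝ, 0 < δ → ∀ᵐ ω ∂P, ∀ᶠ n : ℕ in atTop,
      |ballAverage μ T f n ω - ∫ x, f x ∂P| ≤ 3 * δ := by
    intro δ hδ
    have hle : ∀ ε : ℝ, 0 < ε → ε ≤ δ → ENNReal.ofReal δ * P {ω | ¬ ∀ᶠ n : ℕ in atTop,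
        |ballAverage μ T f n ω - ∫ x, f x ∂P| ≤ 3 * δ} ≤
        10 ^ Module.finrank ℝ E * ENNReal.ofReal ε := by
      intro ε hε hεδ
      obtain ⟨g, hgm, hg, hgconv, hfg⟩ := h ε hε
      have hmean : |∫ x, g x ∂P - ∫ x, f x ∂P| ≤ δ := by
        rw [abs_sub_comm, ← integral_sub hf hg, ← Real.norm_eq_abs]
        refine (norm_integral_le_lintegral_norm _).trans
          (ENNReal.toReal_le_of_le_ofReal hδ.le ?_)
        simp only [ofReal_norm]
        exact hfg.trans (ENNReal.ofReal_le_ofReal hεδ)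
      refine le_trans ?_ ((hT.mul_measure_exists_gt (μ := μ) (hfm.sub hgm).enorm
        (ENNReal.ofReal δ)).trans (by gcongr; exact hfg))
      refine mul_le_mul_right (measure_mono_ae ?_) _
      filter_upwards [hgconv, hT.ae_integrableOn_orbit (μ := μ) hfm hf,
        hT.ae_integrableOn_orbit (μ := μ) hgm hg] with ω hω hfi hgi hbad
      by_contra hmax
      refine hbad ?_
      have hclose : ∀ᶠ n : ℕ in atTop, |ballAverage μ T g n ω - ∫ x, g x ∂P| < δ :=
        hω (Metric.ball_mem_nhds _ hδ)
      filter_upwards [hclose, eventually_ge_atTop 1] with n hn hn1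
      have hv : 0 < (μ (closedBall (0 : E) n)).toReal :=
        ENNReal.toReal_pos (measure_closedBall_pos μ _ (by exact_mod_cast hn1)).ne'
          measure_closedBall_lt_top.ne
      have hdiff : |ballAverage μ T f n ω - ballAverage μ T g n ω| ≤ δ := by
        rw [ballAverage, ballAverage, ← mul_sub, ← integral_sub (hfi n) (hgi n), abs_mul,
          abs_of_pos (inv_pos.2 hv), inv_mul_le_iff₀ hv, ← Real.norm_eq_abs]
        refine (norm_integral_le_lintegral_norm _).trans
          (ENNReal.toReal_le_of_le_ofReal (by positivity) ?_)
        simp only [ofReal_norm]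
        rw [mul_comm, ENNReal.ofReal_mul hδ.le, ENNReal.ofReal_toReal measure_closedBall_lt_top.ne]
        exact not_lt.1 fun hlt => hmax ⟨n, hn1, hlt⟩
      rw [abs_le] at *
      rw [abs_lt] at hn
      constructor <;> linarith
    have hzero : ENNReal.ofReal δ * P {ω | ¬ ∀ᶠ n : ℕ in atTop,
        |ballAverage μ T f n ω - ∫ x, f x ∂P| ≤ 3 * δ} ≤ 0 := by
      have hlim : Tendsto (fun ε : ℝ => (10 : ℝ≥0∞) ^ Module.finrank ℝ E * ENNReal.ofReal ε)
          (𝓝[>] 0) (𝓝 (10 ^ Module.finrank ℝ E * ENNReal.ofReal 0)) :=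
        (ENNReal.Tendsto.const_mul (ENNReal.continuous_ofReal.tendsto 0)
          (Or.inr (by finiteness))).mono_left nhdsWithin_le_nhds
      rw [ENNReal.ofReal_zero, mul_zero] at hlim
      refine ge_of_tendsto hlim ?_
      filter_upwards [Ioc_mem_nhdsGT hδ] with ε hε using hle ε hε.1 hε.2
    rw [ae_iff]
    exact (mul_eq_zero.1 (le_zero_iff.1 hzero)).resolve_left (ENNReal.ofReal_pos.2 hδ).ne'
  have hall : ∀ᵐ ω ∂P, ∀ k : ℕ, ∀ᶠ n : ℕ in atTop,
      |ballAverage μ T f n ω - ∫ x, f x ∂P| ≤ 3 * (1 / ((k : ℝ) + 1)) :=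
    ae_all_iff.2 fun k => key _ Nat.one_div_pos_of_nat
  filter_upwards [hall] with ω hω
  rw [Metric.tendsto_nhds]
  intro ε hε
  obtain ⟨k, hk⟩ := exists_nat_one_div_lt (show 0 < ε / 3 by positivity)
  filter_upwards [hω k] with n hn
  rw [Real.dist_eq]
  linarith

theorem averageTendsto_add (hT : IsMeasurePreservingFlow P T) {f g : Ω → ℝ}
    (hfm : Measurable f) (hf : Integrable f P) (hgm : Measurable g) (hg : Integrable g P)
    (hfconv : AverageTendsto μ P T f) (hgconv : AverageTendsto μ P T g) :
    AverageTendsto μ P T (f + g) := by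
  filter_upwards [hfconv, hgconv, hT.ae_integrableOn_orbit (μ := μ) hfm hf,
    hT.ae_integrableOn_orbit (μ := μ) hgm hg] with ω hfω hgω hfi hgi
  simp only [Pi.add_apply]
  rw [integral_add hf hg]
  refine (hfω.add hgω).congr fun n => ?_
  simp only [ballAverage, Pi.add_apply]
  rw [integral_add (hfi n) (hgi n), mul_add]

theorem averageTendsto_indicator_preimage_sub (hT : IsMeasurePreservingFlow P T) (s : E)
    {A : Set Ω} (hA : MeasurableSet A) :
    AverageTendsto μ P T ((T s ⁻¹' A).indicator (fun _ => 1) - A.indicator fun _ => 1) := by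
  have hA' : MeasurableSet (T s ⁻¹' A) := (hT.measurePreserving s).measurable hA
  have hmean : ∫ ω, ((T s ⁻¹' A).indicator (fun _ => (1 : ℝ)) - A.indicator fun _ => (1 : ℝ)) ω ∂P
      = 0 := by
    simp only [Pi.sub_apply]
    rw [integral_sub ((integrable_const _).indicator hA') ((integrable_const _).indicator hA),
      integral_indicator_const _ hA', integral_indicator_const _ hA, Measure.real, Measure.real,
      (hT.measurePreserving s).measure_preimage hA.nullMeasurableSet, sub_self]
  refine ae_of_all _ fun ω => ?_
  rw [hmean]
  set D : Set E := (fun t => T t ω) ⁻¹' A with hD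
  have hDm : MeasurableSet D := hT.measurable_orbit ω hA
  have hDm' : MeasurableSet ((fun t => s + t) ⁻¹' D) := measurable_const_add s hDm
  have hint : ∀ n : ℕ, ∫ t in closedBall (0 : E) n,
      ((T s ⁻¹' A).indicator (fun _ => (1 : ℝ)) - A.indicator fun _ => (1 : ℝ)) (T t ω) ∂μ =
      μ.real (D ∩ closedBall s n) - μ.real (D ∩ closedBall 0 n) := by
    intro n
    have hfin : IsFiniteMeasure (μ.restrict (closedBall (0 : E) n)) :=
      ⟨by simpa using measure_closedBall_lt_top⟩
    have h1 : ∀ t,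
        ((T s ⁻¹' A).indicator (fun _ => (1 : ℝ)) - A.indicator fun _ => (1 : ℝ)) (T t ω) =
        ((fun t => s + t) ⁻¹' D).indicator (fun _ => (1 : ℝ)) t - D.indicator (fun _ => 1) t := by
      intro t
      have hDs : (fun t => s + t) ⁻¹' D = (fun t => T t ω) ⁻¹' (T s ⁻¹' A) := by
        ext t; simp [hD, hT.add]
      rw [hDs]
      rfl
    simp only [h1]
    rw [integral_sub ((integrable_const _).indicator hDm') ((integrable_const _).indicator hDm),
      integral_indicator_const _ hDm', integral_indicator_const _ hDm]
    simp only [smul_eq_mul, mul_one]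
    rw [measureReal_restrict_apply hDm', measureReal_restrict_apply hDm]
    have hpre : (fun t => s + t) ⁻¹' D ∩ closedBall 0 (n : ℝ) =
        (fun t => s + t) ⁻¹' (D ∩ closedBall s n) := by
      ext t; simp
    rw [hpre, Measure.real, measure_preimage_add, ← Measure.real]
  set k := Module.finrank ℝ E with hk
  have hlim : Tendsto (fun n : ℕ => (1 + ‖s‖ / (n : ℝ)) ^ k - 1) atTop (𝓝 0) := by
    have : Tendsto (fun n : ℕ => ‖s‖ / (n : ℝ)) atTop (𝓝 0) :=
      tendsto_const_div_atTop_nhds_zero_nat _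
    simpa using (((this.const_add 1).pow k).sub_const 1)
  refine squeeze_zero_norm' ?_ hlim
  filter_upwards [eventually_ge_atTop 1] with n hn
  have hn0 : (0 : ℝ) < n := by exact_mod_cast hn
  have hball : ∀ r : ℝ, 0 ≤ r → μ.real (closedBall (0 : E) r) = r ^ k * μ.real (ball (0 : E) 1) :=
    fun r hr => by
      rw [Measure.real, Measure.addHaar_closedBall μ _ hr, ENNReal.toReal_mul,
        ENNReal.toReal_ofReal (by positivity), Measure.real]
  have hv : 0 < μ.real (ball (0 : E) 1) :=
    ENNReal.toReal_pos (measure_ball_pos μ _ one_pos).ne' measure_ball_lt_top.ne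
  have h1 := measureReal_inter_closedBall_le (μ := μ) D s 0 n
  have h2 := measureReal_inter_closedBall_le (μ := μ) D 0 s n
  rw [dist_zero_right, hball _ (by positivity), hball _ hn0.le] at h1
  rw [dist_zero_left, hball _ (by positivity), hball _ hn0.le] at h2
  rw [ballAverage, hint, ← Measure.real, hball _ hn0.le, Real.norm_eq_abs, abs_mul,
    abs_of_pos (by positivity), inv_mul_le_iff₀ (by positivity)]
  have hexp : (n : ℝ) ^ k * μ.real (ball (0 : E) 1) * ((1 + ‖s‖ / (n : ℝ)) ^ k - 1) =
      ((n : ℝ) + ‖s‖) ^ k * μ.real (ball (0 : E) 1) - (n : ℝ) ^ k * μ.real (ball (0 : E) 1) := by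
    have : (n : ℝ) + ‖s‖ = n * (1 + ‖s‖ / (n : ℝ)) := by field_simp
    rw [this, mul_pow]
    ring
  rw [hexp, abs_le]
  constructor <;> linarith

/-- If a set is almost invariant under each time map of an ergodic flow, its measure is `0` or
`1`. -/
theorem measure_eq_zero_or_one_of_ae_invariant (μ : Measure E) [μ.IsAddHaarMeasure]
    (hT : IsMeasurePreservingFlow P T)
    (herg : ∀ A : Set Ω, MeasurableSet A → (∀ t, T t ⁻¹' A = A) → P A = 0 ∨ P A = 1)
    {A : Set Ω} (hA : MeasurableSet A) (hinv : ∀ t, ∀ᵐ ω ∂P, T t ω ∈ A ↔ ω ∈ A) :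
    P A = 0 ∨ P A = 1 := by
  set B : Set Ω := {ω | ∀ᵐ t ∂μ, T t ω ∈ A} with hB
  have hBm : MeasurableSet B := by
    have : B = {ω | μ (Prod.mk ω ⁻¹' ((fun p : Ω × E => T p.2 p.1) ⁻¹' Aᶜ)) = 0} := by
      ext ω; simp [hB, ae_iff]; rfl
    rw [this]
    exact measurable_measure_prodMk_left
      ((hT.measurable.comp measurable_swap) hA.compl) (measurableSet_singleton 0)
  have hBinv : ∀ t, T t ⁻¹' B = B := by
    intro s
    ext ω
    simp only [hB, mem_preimage, mem_ofPred_eq]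
    have : ∀ t, T t (T s ω) = T (t + s) ω := fun t => by simp [hT.add]
    simp only [this]
    exact eventually_add_right_iff μ s (p := fun t => T t ω ∈ A)
  have hAB : A =ᵐ[P] B := by
    have hset : MeasurableSet {p : E × Ω | T p.1 p.2 ∈ A ↔ p.2 ∈ A} :=
      (hT.measurable hA).iff (measurable_snd hA)
    filter_upwards [(Measure.ae_ae_comm (μ := μ) (p := fun t ω => T t ω ∈ A ↔ ω ∈ A) hset).1
      (ae_of_all _ hinv)] with ω hω
    refine propext ⟨fun h => ?_, fun h => ?_⟩
    · exact hω.mono fun t ht => ht.2 h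
    · obtain ⟨t, h1, h2⟩ := (hω.and (show ∀ᵐ t ∂μ, T t ω ∈ A from h)).exists
      exact h1.1 h2
  rw [measure_congr hAB]
  exact herg B hBm hBinv

/-- The square-integrable functions whose ball averages converge to their mean. -/
def convergenceSubmodule (μ : Measure E) [μ.IsAddHaarMeasure]
    (hT : IsMeasurePreservingFlow P T) : Submodule ℝ (Lp ℝ 2 P) where
  carrier := {f | AverageTendsto μ P T f}
  zero_mem' := hT.averageTendsto_congr (Lp.coeFn_zero ℝ 2 P).symm (averageTendsto_const 0)
  add_mem' {f g} hf hg := hT.averageTendsto_congr (Lp.coeFn_add f g).symm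
    (hT.averageTendsto_add (Lp.stronglyMeasurable f).measurable
      ((Lp.memLp f).integrable one_le_two) (Lp.stronglyMeasurable g).measurable
      ((Lp.memLp g).integrable one_le_two) hf hg)
  smul_mem' c f hf := hT.averageTendsto_congr (Lp.coeFn_smul c f).symm
    (averageTendsto_const_smul c hf)

theorem mem_convergenceSubmodule (hT : IsMeasurePreservingFlow P T) {f : Lp ℝ 2 P} :
    f ∈ hT.convergenceSubmodule μ ↔ AverageTendsto μ P T f := Iff.rfl

theorem isClosed_convergenceSubmodule (hT : IsMeasurePreservingFlow P T) :
    IsClosed (hT.convergenceSubmodule μ : Set (Lp ℝ 2 P)) := by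
  refine isClosed_of_closure_subset fun f hf => ?_
  refine hT.averageTendsto_of_forall_approx (Lp.stronglyMeasurable f).measurable
    ((Lp.memLp f).integrable one_le_two) fun ε hε => ?_
  obtain ⟨g, hg, hfg⟩ := EMetric.mem_closure_iff.1 hf (ENNReal.ofReal ε) (by simpa)
  refine ⟨g, (Lp.stronglyMeasurable g).measurable, (Lp.memLp g).integrable one_le_two, hg, ?_⟩
  calc ∫⁻ ω, ‖f ω - g ω‖ₑ ∂P = eLpNorm (f - g : Ω → ℝ) 1 P := by
        rw [eLpNorm_one_eq_lintegral_enorm]; rfl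
    _ ≤ eLpNorm (f - g : Ω → ℝ) 2 P := eLpNorm_le_eLpNorm_of_exponent_le one_le_two
        ((Lp.aestronglyMeasurable f).sub (Lp.aestronglyMeasurable g))
    _ = edist f g := (Lp.edist_def f g).symm
    _ ≤ _ := hfg.le

theorem convergenceSubmodule_eq_top (hT : IsMeasurePreservingFlow P T)
    (herg : ∀ A : Set Ω, MeasurableSet A → (∀ t, T t ⁻¹' A = A) → P A = 0 ∨ P A = 1) :
    hT.convergenceSubmodule μ = ⊤ := by
  have : CompleteSpace (hT.convergenceSubmodule μ) :=
    (hT.isClosed_convergenceSubmodule (μ := μ)).completeSpace_coe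
  rw [← Submodule.orthogonal_eq_bot_iff, Submodule.eq_bot_iff]
  intro h hh
  rw [Submodule.mem_orthogonal] at hh
  have hhm : Measurable h := (Lp.stronglyMeasurable h).measurable
  have hhi : Integrable h P := (Lp.memLp h).integrable one_le_two
  have hmean : ∫ ω, h ω ∂P = 0 := by
    have hmem : indicatorConstLp 2 (MeasurableSet.univ (α := Ω)) (measure_ne_top P _) (1 : ℝ) ∈
        hT.convergenceSubmodule μ :=
      hT.mem_convergenceSubmodule.2
        (hT.averageTendsto_congr indicatorConstLp_coeFn.symm (by
          simpa using averageTendsto_const 1))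
    have := hh _ hmem
    rwa [L2.inner_indicatorConstLp_one, setIntegral_univ] at this
  have hset : ∀ (s : E) {A : Set Ω}, MeasurableSet A →
      ∫ ω in T s ⁻¹' A, h ω ∂P = ∫ ω in A, h ω ∂P := by
    intro s A hA
    have hA' : MeasurableSet (T s ⁻¹' A) := (hT.measurePreserving s).measurable hA
    have hmem : indicatorConstLp 2 hA' (measure_ne_top P _) (1 : ℝ) -
        indicatorConstLp 2 hA (measure_ne_top P _) (1 : ℝ) ∈ hT.convergenceSubmodule μ :=
      hT.mem_convergenceSubmodule.2 (hT.averageTendsto_congr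
        ((indicatorConstLp_coeFn.symm.sub indicatorConstLp_coeFn.symm).trans
          (Lp.coeFn_sub _ _).symm) (hT.averageTendsto_indicator_preimage_sub s hA))
    have := hh _ hmem
    rwa [inner_sub_left, L2.inner_indicatorConstLp_one, L2.inner_indicatorConstLp_one,
      sub_eq_zero] at this
  have hinv : ∀ s, (fun ω => h (T s ω)) =ᵐ[P] h := by
    intro s
    have hcomp : Integrable (fun ω => h (T s ω)) P :=
      (hT.measurePreserving s).integrable_comp_of_integrable hhi
    refine hcomp.ae_eq_of_forall_setIntegral_eq _ _ hhi fun B hB _ => ?_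
    have hA : MeasurableSet (T (-s) ⁻¹' B) := (hT.measurePreserving (-s)).measurable hB
    have hBA : B = T s ⁻¹' (T (-s) ⁻¹' B) := by
      rw [← preimage_comp, ← hT.add, neg_add_cancel, hT.zero, preimage_id]
    have hmap : ∫ ω in T s ⁻¹' (T (-s) ⁻¹' B), h (T s ω) ∂P = ∫ ω in T (-s) ⁻¹' B, h ω ∂P := by
      have := setIntegral_map (μ := P) (f := h) hA hhm.aestronglyMeasurable
        (hT.measurePreserving s).aemeasurable
      rw [(hT.measurePreserving s).map_eq] at this
      exact this.symm
    rw [← hBA] at hmap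
    rw [hmap, ← hset s hA, ← hBA]
  have hpos : P {ω | 0 < h ω} = 0 ∨ P {ω | 0 < h ω} = 1 := by
    refine hT.measure_eq_zero_or_one_of_ae_invariant μ herg (measurableSet_lt measurable_const hhm)
      fun s => ?_
    filter_upwards [hinv s] with ω hω
    simp [hω]
  rw [Lp.eq_zero_iff_ae_eq_zero]
  rcases hpos with hpos | hpos
  · have hneg : 0 ≤ᵐ[P] fun ω => -h ω := by
      filter_upwards [measure_eq_zero_iff_ae_notMem.1 hpos] with ω hω
      simpa using hω
    have := (integral_eq_zero_iff_of_nonneg_ae hneg hhi.neg).1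
      (by rw [integral_neg, hmean, neg_zero])
    filter_upwards [this] with ω hω
    simpa using hω
  · have hae : ∀ᵐ ω ∂P, 0 < h ω :=
      (prob_compl_eq_zero_iff (measurableSet_lt measurable_const hhm)).2 hpos
    exact (integral_eq_zero_iff_of_nonneg_ae (hae.mono fun _ hω => hω.le) hhi).1 hmean

/-- The pointwise ergodic theorem for ball averages of an ergodic flow. -/
theorem averageTendsto_of_ergodic (hT : IsMeasurePreservingFlow P T)
    (herg : ∀ A : Set Ω, MeasurableSet A → (∀ t, T t ⁻¹' A = A) → P A = 0 ∨ P A = 1)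
    {f : Ω → ℝ} (hf : Integrable f P) : AverageTendsto μ P T f := by
  have hL2 : ∀ g : Ω → ℝ, MemLp g 2 P → AverageTendsto μ P T g := fun g hg =>
    hT.averageTendsto_congr hg.coeFn_toLp (hT.mem_convergenceSubmodule.1
      (hT.convergenceSubmodule_eq_top (μ := μ) herg ▸ Submodule.mem_top))
  have hfm : Measurable (hf.1.mk f) := hf.1.stronglyMeasurable_mk.measurable
  have hfi : Integrable (hf.1.mk f) P := hf.congr hf.1.ae_eq_mk
  refine hT.averageTendsto_congr hf.1.ae_eq_mk.symm
    (hT.averageTendsto_of_forall_approx hfm hfi fun ε hε => ?_)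
  obtain ⟨g, hfg, -⟩ := (memLp_one_iff_integrable.2 hfi).exists_simpleFunc_eLpNorm_sub_lt
    ENNReal.one_ne_top (ε := ENNReal.ofReal ε) (by simpa)
  refine ⟨g, g.measurable, g.integrable_of_isFiniteMeasure,
    hL2 g (g.memLp_of_isFiniteMeasure 2 P), ?_⟩
  rw [eLpNorm_one_eq_lintegral_enorm] at hfg
  exact hfg.le

end IsMeasurePreservingFlow

end ErgodicFlow

/-- Individual ergodic theorem for measure-preserving ergodic `ℝ^d`-actions,
averaged over Euclidean balls. -/
theorem pointwise_ergodic_theorem_ball_averages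
    (d : ℕ) (hd : 1 ≤ d)
    {Ω : Type*} [MeasurableSpace Ω] (P : Measure Ω) [IsProbabilityMeasure P]
    (T : EuclideanSpace ℝ (Fin d) → Ω → Ω)
    (hTmeas : Measurable fun p : EuclideanSpace ℝ (Fin d) × Ω => T p.1 p.2)
    (hT0 : T 0 = id)
    (hTadd : ∀ s t : EuclideanSpace ℝ (Fin d), T (s + t) = T s ∘ T t)
    (hTmp : ∀ t : EuclideanSpace ℝ (Fin d), MeasurePreserving (T t) P P)
    (herg : ∀ A : Set Ω, MeasurableSet A →
      (∀ t : EuclideanSpace ℝ (Fin d), T t ⁻¹' A = A) → P A = 0 ∨ P A = 1)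
    (f : Ω → ℝ) (hf : Integrable f P) :
    ∀ᵐ ω ∂P, Tendsto
      (fun n : ℕ =>
        (volume (Metric.closedBall (0 : EuclideanSpace ℝ (Fin d)) n)).toReal⁻¹ *
          ∫ t in Metric.closedBall (0 : EuclideanSpace ℝ (Fin d)) (n : ℝ), f (T t ω))
      atTop (nhds (∫ ω, f ω ∂P)) := by
  have hT : ErgodicFlow.IsMeasurePreservingFlow P T := ⟨hTmeas, hT0, hTadd, hTmp⟩
  exact hT.averageTendsto_of_ergodic herg hf
end

section
/- Let d ≥ 1, let μ be a locally finite Borel measure on ℝ^d, and let c ∈ [0, ∞). If the ball averages (1/λ_d(B_n)) ∫_{B_n} μ(B_1 + t) λ_d(dt) converge to c as n → ∞ over the natural numbers, then μ(B_n)/λ_d(B_n) converges to c/λ_d(B_1) as n → ∞. -/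
open MeasureTheory Filter

section BallMass

variable {E : Type*} [NormedAddCommGroup E] [MeasurableSpace E] [BorelSpace E]

/-- Tonelli's theorem for the incidence relation `dist x t ≤ r`. -/
lemma setLIntegral_measure_closedBall [SecondCountableTopology E] (μ ν : Measure E) [SFinite μ]
    [SFinite ν] (A : Set E) (r : ℝ) :
    ∫⁻ t in A, μ (Metric.closedBall t r) ∂ν = ∫⁻ x, ν.restrict A (Metric.closedBall x r) ∂μ := by
  have hS : MeasurableSet {p : E × E | dist p.2 p.1 ≤ r} :=
    (isClosed_le (continuous_snd.dist continuous_fst) continuous_const).measurableSet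
  have hleft := Measure.prod_apply (μ := ν.restrict A) (ν := μ) hS
  have hright := Measure.prod_apply_symm (μ := ν.restrict A) (ν := μ) hS
  rw [hleft] at hright
  refine hright.trans (lintegral_congr fun x => congrArg _ ?_)
  ext t
  simp [dist_comm]

variable [NormedSpace ℝ E] [FiniteDimensional ℝ E]

/-- Upper bound for the integral of `t ↦ μ (closedBall t r)` over a ball by the `μ`-mass of the
enlarged ball. -/
lemma setLIntegral_measure_closedBall_le (μ ν : Measure E) [SFinite μ] [ν.IsAddHaarMeasure]
    (R r : ℝ) :
    ∫⁻ t in Metric.closedBall 0 R, μ (Metric.closedBall t r) ∂ν ≤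
      ν (Metric.closedBall 0 r) * μ (Metric.closedBall 0 (R + r)) := by
  have := FiniteDimensional.proper_real E
  rw [setLIntegral_measure_closedBall, ← setLIntegral_const,
    ← lintegral_indicator Metric.isClosed_closedBall.measurableSet]
  refine lintegral_mono fun x => ?_
  by_cases hx : x ∈ Metric.closedBall (0 : E) (R + r)
  · rw [Set.indicator_of_mem hx, ← Measure.addHaar_closedBall_center ν x r]
    exact Measure.restrict_apply_le _ _
  · rw [Set.indicator_of_notMem hx, Measure.restrict_apply Metric.isClosed_closedBall.measurableSet,
      Set.disjoint_iff_inter_eq_empty.mp, measure_empty]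
    refine Metric.closedBall_disjoint_closedBall ?_
    rw [Metric.mem_closedBall, not_le] at hx
    linarith

/-- Lower bound for the integral of `t ↦ μ (closedBall t r)` over an enlarged ball by the `μ`-mass
of the original ball. -/
lemma measure_closedBall_mul_le_setLIntegral (μ ν : Measure E) [SFinite μ]
    [ν.IsAddHaarMeasure] (R r : ℝ) :
    ν (Metric.closedBall 0 r) * μ (Metric.closedBall 0 R) ≤
      ∫⁻ t in Metric.closedBall 0 (R + r), μ (Metric.closedBall t r) ∂ν := by
  have := FiniteDimensional.proper_real E
  rw [setLIntegral_measure_closedBall, ← setLIntegral_const,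
    ← lintegral_indicator Metric.isClosed_closedBall.measurableSet]
  refine lintegral_mono fun x => ?_
  by_cases hx : x ∈ Metric.closedBall (0 : E) R
  · rw [Set.indicator_of_mem hx, ← Measure.addHaar_closedBall_center ν x r,
      Measure.restrict_apply Metric.isClosed_closedBall.measurableSet]
    refine measure_mono (Set.subset_inter subset_rfl (Metric.closedBall_subset_closedBall' ?_))
    rw [Metric.mem_closedBall] at hx
    linarith
  · simp [Set.indicator_of_notMem hx]

/-- Consecutive integer balls have asymptotically equal Haar measure. -/
lemma tendsto_addHaar_closedBall_succ_div (ν : Measure E) [ν.IsAddHaarMeasure] :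
    Tendsto (fun n : ℕ => (ν (Metric.closedBall 0 ((n + 1 : ℕ) : ℝ))).toReal /
      (ν (Metric.closedBall 0 (n : ℝ))).toReal) atTop (nhds 1) := by
  have := FiniteDimensional.proper_real E
  have hpos : 0 < (ν (Metric.closedBall 0 1)).toReal :=
    ENNReal.toReal_pos (Metric.measure_closedBall_pos ν 0 one_pos).ne'
      measure_closedBall_lt_top.ne
  have hvol (n : ℕ) : (ν (Metric.closedBall 0 (n : ℝ))).toReal =
      (n : ℝ) ^ Module.finrank ℝ E * (ν (Metric.closedBall 0 1)).toReal := by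
    rw [Measure.addHaar_closedBall' ν 0 n.cast_nonneg, ENNReal.toReal_mul,
      ENNReal.toReal_ofReal (by positivity)]
  have hratio : Tendsto (fun n : ℕ => (1 + 1 / (n : ℝ)) ^ Module.finrank ℝ E) atTop (nhds 1) := by
    simpa using (tendsto_one_div_atTop_nhds_zero_nat (𝕜 := ℝ)).const_add 1 |>.pow
      (Module.finrank ℝ E)
  refine hratio.congr' ?_
  filter_upwards [eventually_gt_atTop 0] with n hn
  have hn' : (0 : ℝ) < n := by exact_mod_cast hn
  rw [hvol, hvol, mul_div_mul_right _ _ hpos.ne', ← div_pow]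
  push_cast
  rw [add_div, div_self hn'.ne']

end BallMass

/-- If the ball averages of `t ↦ μ(B_1 + t)` converge to `c`, then the normalized
ball masses `μ(B_n)/λ_d(B_n)` converge to `c / λ_d(B_1)`. -/
theorem tendsto_ball_mass_of_tendsto_ball_averages
    (d : ℕ) (hd : 1 ≤ d)
    (μ : Measure (EuclideanSpace ℝ (Fin d))) [IsLocallyFiniteMeasure μ]
    (c : ℝ) (hc : 0 ≤ c)
    (havg : Tendsto
      (fun n : ℕ =>
        (volume (Metric.closedBall (0 : EuclideanSpace ℝ (Fin d)) n)).toReal⁻¹ *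
          (∫⁻ t in Metric.closedBall (0 : EuclideanSpace ℝ (Fin d)) (n : ℝ),
            μ (Metric.closedBall t 1)).toReal)
      atTop (nhds c)) :
    Tendsto
      (fun n : ℕ =>
        (μ (Metric.closedBall (0 : EuclideanSpace ℝ (Fin d)) (n : ℝ))).toReal /
          (volume (Metric.closedBall (0 : EuclideanSpace ℝ (Fin d)) n)).toReal)
      atTop
      (nhds (c / (volume (Metric.closedBall (0 : EuclideanSpace ℝ (Fin d)) 1)).toReal)) := by
  set V : ℕ → ℝ := fun n =>
    (volume (Metric.closedBall (0 : EuclideanSpace ℝ (Fin d)) (n : ℝ))).toReal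
  set M : ℕ → ℝ := fun n =>
    (μ (Metric.closedBall (0 : EuclideanSpace ℝ (Fin d)) (n : ℝ))).toReal with hM
  set I : ℕ → ℝ := fun n =>
    (∫⁻ t in Metric.closedBall (0 : EuclideanSpace ℝ (Fin d)) (n : ℝ),
      μ (Metric.closedBall t 1)).toReal
  set v : ℝ := (volume (Metric.closedBall (0 : EuclideanSpace ℝ (Fin d)) 1)).toReal with hv
  change Tendsto (fun n => (V n)⁻¹ * I n) atTop (nhds c) at havg
  change Tendsto (fun n => M n / V n) atTop (nhds (c / v))
  have hvpos : 0 < v := ENNReal.toReal_pos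
    (Metric.measure_closedBall_pos volume 0 one_pos).ne' measure_closedBall_lt_top.ne
  have hVpos (n : ℕ) : 0 < V (n + 1) := ENNReal.toReal_pos
    (Metric.measure_closedBall_pos volume 0 (by positivity)).ne' measure_closedBall_lt_top.ne
  have hupper (n : ℕ) :
      ∫⁻ t in Metric.closedBall (0 : EuclideanSpace ℝ (Fin d)) (n : ℝ),
        μ (Metric.closedBall t 1) ≤
      volume (Metric.closedBall (0 : EuclideanSpace ℝ (Fin d)) 1) *
        μ (Metric.closedBall 0 ((n + 1 : ℕ) : ℝ)) := by
    exact_mod_cast setLIntegral_measure_closedBall_le μ volume (n : ℝ) 1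
  have hfin (n : ℕ) : volume (Metric.closedBall (0 : EuclideanSpace ℝ (Fin d)) 1) *
      μ (Metric.closedBall 0 (n : ℝ)) ≠ ⊤ :=
    ENNReal.mul_ne_top measure_closedBall_lt_top.ne measure_closedBall_lt_top.ne
  have hI_le (n : ℕ) : I n ≤ v * M (n + 1) := by
    rw [hv, hM, ← ENNReal.toReal_mul]
    exact ENNReal.toReal_mono (hfin _) (hupper n)
  have hle_I (n : ℕ) : v * M n ≤ I (n + 1) := by
    rw [hv, hM, ← ENNReal.toReal_mul]
    refine ENNReal.toReal_mono (ne_top_of_le_ne_top (hfin _) (hupper (n + 1))) ?_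
    exact_mod_cast measure_closedBall_mul_le_setLIntegral μ volume (n : ℝ) 1
  have hratio : Tendsto (fun n => V (n + 1) / V n) atTop (nhds 1) :=
    tendsto_addHaar_closedBall_succ_div volume
  rw [← tendsto_add_atTop_iff_nat 1]
  have hlower_lim : Tendsto (fun n => (V n)⁻¹ * I n / (V (n + 1) / V n) / v) atTop
      (nhds (c / v)) := by
    simpa using (havg.div hratio one_ne_zero).div_const v
  have hupper_lim : Tendsto (fun n => (V (n + 2))⁻¹ * I (n + 2) * (V (n + 2) / V (n + 1)) / v)
      atTop (nhds (c / v)) := by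
    simpa using ((havg.comp (tendsto_add_atTop_nat 2)).mul
      (hratio.comp (tendsto_add_atTop_nat 1))).div_const v
  refine tendsto_of_tendsto_of_tendsto_of_le_of_le' hlower_lim hupper_lim ?_ ?_
  · filter_upwards [eventually_ge_atTop 1] with n hn
    obtain ⟨k, rfl⟩ := Nat.exists_eq_add_of_le' hn
    have hk := hVpos k
    have hk' := hVpos (k + 1)
    calc (V (k + 1))⁻¹ * I (k + 1) / (V (k + 1 + 1) / V (k + 1)) / v
        = I (k + 1) / v / V (k + 1 + 1) := by field_simp
      _ ≤ M (k + 1 + 1) / V (k + 1 + 1) := by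
        gcongr
        exact (div_le_iff₀' hvpos).mpr (hI_le _)
  · refine Eventually.of_forall fun n => ?_
    have hn := hVpos n
    have hn' : 0 < V (n + 2) := hVpos (n + 1)
    calc M (n + 1) / V (n + 1) ≤ I (n + 2) / v / V (n + 1) := by
          gcongr
          exact (le_div_iff₀' hvpos).mpr (hle_I _)
      _ = (V (n + 2))⁻¹ * I (n + 2) * (V (n + 2) / V (n + 1)) / v := by field_simp
end
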